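/- Let g be any finite composition of the functions f₁ and f₂ in which f₁ and f₂ each occur exactly α times and in which, reading the composition as applied left-to-right, at every proper prefix the number of applications of f₂ is at least the number of applications of f₁ (as in the ballot-type condition of the paper). Then for every real number x > 0, g(x) ≤ (f₂ ∘ f₁)^[α](x); in particular, combining with the paper's Lemma, g(x) < x for x > 2. -/

import Mathlib

noncomputable def f₁ : ℝ → ℝ := fun x => x / 2
noncomputable def f₂ : ℝ → ℝ := fun x => (3 * x + 1) / 2

/-- Apply the composition determined by a word `w` in the alphabet `{f₁, f₂}`,
reading `w` left-to-right (the head of the list is applied first).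
Here `false` encodes the letter `1` (apply `f₁`) and `true` encodes the letter `2`
(apply `f₂`). -/
noncomputable def applyWord (w : List Bool) (x : ℝ) : ℝ :=
  w.foldl (fun y b => if b then f₂ y else f₁ y) x

theorem monotone_f₁ : Monotone f₁ := fun a b h => by simp only [f₁]; linarith

theorem monotone_f₂ : Monotone f₂ := fun a b h => by simp only [f₂]; linarith

theorem f₁_iterate_f₂_le (d : ℕ) (y : ℝ) : f₁ (f₂^[d] y) ≤ f₂^[d] (f₁ y) := by
  induction d with
  | zero => rfl
  | succ d ih =>
    rw [Function.iterate_succ_apply', Function.iterate_succ_apply']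
    refine le_trans ?_ (monotone_f₂ ih)
    simp only [f₁, f₂]
    linarith

theorem applyWord_append_singleton (w : List Bool) (b : Bool) (x : ℝ) :
    applyWord (w ++ [b]) x = if b then f₂ (applyWord w x) else f₁ (applyWord w x) := by
  simp [applyWord]

/-- Among the words whose prefixes contain at least as many `true`s as `false`s, the value is
bounded by that of the word alternating `false`, `true` and ending with the excess `true`s. -/
theorem applyWord_le_of_prefix (x : ℝ) (w : List Bool)
    (h : ∀ p, p <+: w → p.count false ≤ p.count true) :
    applyWord w x ≤ f₂^[w.count true - w.count false] ((f₂ ∘ f₁)^[w.count false] x) := by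
  induction w using List.reverseRecOn with
  | nil => simp [applyWord]
  | append_singleton w b ih =>
    have hw := h w (List.prefix_append w [b])
    have hwb := h _ List.prefix_rfl
    replace ih := ih fun p hp => h p (hp.trans (List.prefix_append w [b]))
    rw [applyWord_append_singleton]
    cases b with
    | true =>
      have hd : (w ++ [true]).count true - (w ++ [true]).count false =
          (w.count true - w.count false) + 1 := by
        simp; omega
      have hc : (w ++ [true]).count false = w.count false := by simp
      rw [hd, hc, Function.iterate_succ_apply']
      exact monotone_f₂ ih
    | false =>
      have hc : (w ++ [false]).count false = w.count false + 1 := by simp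
      have ht : (w ++ [false]).count true = w.count true := by simp
      have hd : w.count true - w.count false =
          (w.count true - (w.count false + 1)) + 1 := by omega
      rw [ht, hc, Function.iterate_succ_apply' (f₂ ∘ f₁), Function.comp_apply,
        ← Function.iterate_succ_apply f₂, Nat.succ_eq_add_one, ← hd]
      exact (monotone_f₁ ih).trans (f₁_iterate_f₂_le _ _)

theorem iterate_f₂_comp_f₁_lt {x : ℝ} (hx : 2 < x) (n : ℕ) :
    2 < (f₂ ∘ f₁)^[n + 1] x ∧ (f₂ ∘ f₁)^[n + 1] x < x := by
  induction n with
  | zero =>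
    simp only [zero_add, Function.iterate_one, Function.comp_apply, f₁, f₂]
    constructor <;> linarith
  | succ n ih =>
    rw [Function.iterate_succ_apply']
    generalize (f₂ ∘ f₁)^[n + 1] x = y at ih ⊢
    simp only [Function.comp_apply, f₁, f₂]
    constructor <;> linarith

theorem ballot_word_le (α : ℕ) (hα : 1 ≤ α) (w : List Bool)
    (hlen : w.length = 2 * α)
    (hcount₁ : w.count false = α) (hcount₂ : w.count true = α)
    (hballot : ∀ j : ℕ, (w.take j).count false ≤ (w.take j).count true) :
    ∀ x : ℝ, 0 < x →
      applyWord w x ≤ (f₂ ∘ f₁)^[α] x ∧ (2 < x → applyWord w x < x) := by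
  intro x _
  have hle : applyWord w x ≤ (f₂ ∘ f₁)^[α] x := by
    have h := applyWord_le_of_prefix x w fun p hp => by
      rw [List.prefix_iff_eq_take.mp hp]
      exact hballot _
    simpa [hcount₁, hcount₂] using h
  refine ⟨hle, fun hx => hle.trans_lt ?_⟩
  obtain ⟨n, rfl⟩ := Nat.exists_eq_add_of_le' hα
  exact (iterate_f₂_comp_f₁_lt hx n).2
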